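/- Let G = F_2^n, fix finitely supported G-valued random variables X_1^0, X_2^0, set η = 1/9, and define τ[X_1; X_2] := d[X_1; X_2] + η·d[X_1^0; X_1] + η·d[X_2^0; X_2]. Suppose X_1, X_2 are finitely supported G-valued random variables with d[X_1; X_2] = k, satisfying τ[X_1'; X_2'] ≥ τ[X_1; X_2] for every pair of finitely supported G-valued random variables X_1', X_2'. Let X_1, X_2, X̃_1, X̃_2 be jointly independent, with X̃_1 a copy of X_1 and X̃_2 a copy of X_2, and set I_1 := I[X_1 + X_2 : X̃_1 + X_2 | X_1 + X_2 + X̃_1 + X̃_2]. Then I_2 := I[X_1 + X_2 : X_1 + X̃_1 | X_1 + X_2 + X̃_1 + X̃_2] ≤ 2ηk + 2η(2ηk − I_1)/(1 − η). -/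

import Mathlib

open scoped Classical BigOperators Pointwise
open Finset

noncomputable section

/-- The probability that the random variable `X` equals `s`, under the pmf `μ`. -/
def pmass {Ω S : Type*} [Fintype Ω] (μ : Ω → ℝ) (X : Ω → S) (s : S) : ℝ :=
  ∑ ω, if X ω = s then μ ω else 0

/-- `μ` is a probability mass function on the finite type `Ω`. -/
def IsProb {Ω : Type*} [Fintype Ω] (μ : Ω → ℝ) : Prop :=
  (∀ ω, 0 ≤ μ ω) ∧ ∑ ω, μ ω = 1

/-- Shannon entropy `H[X]` of a random variable `X : Ω → S` under `μ`. -/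
def ent {Ω S : Type*} [Fintype Ω] (μ : Ω → ℝ) (X : Ω → S) : ℝ :=
  ∑ s ∈ Finset.univ.image X, Real.negMulLog (pmass μ X s)

/-- Mutual information `I[X : Y]`. -/
def mutualInfo {Ω S T : Type*} [Fintype Ω] (μ : Ω → ℝ) (X : Ω → S) (Y : Ω → T) : ℝ :=
  ent μ X + ent μ Y - ent μ (fun ω => (X ω, Y ω))

/-- The conditional measure, conditioning on the event `Y = y`. -/
def condMeas {Ω T : Type*} [Fintype Ω] (μ : Ω → ℝ) (Y : Ω → T) (y : T) : Ω → ℝ :=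
  fun ω => if Y ω = y then μ ω / pmass μ Y y else 0

/-- Conditional mutual information `I[X : Y | Z]`. -/
def condMutualInfo {Ω S T U : Type*} [Fintype Ω] (μ : Ω → ℝ)
    (X : Ω → S) (Y : Ω → T) (Z : Ω → U) : ℝ :=
  ∑ z ∈ Finset.univ.image Z, pmass μ Z z * mutualInfo (condMeas μ Z z) X Y

/-- Entropic Ruzsa distance `d[X ; Y]`, defined via independent copies on a product space. -/
def rdist {Ω₁ Ω₂ G : Type*} [Fintype Ω₁] [Fintype Ω₂] [AddCommGroup G]
    (μ₁ : Ω₁ → ℝ) (X : Ω₁ → G) (μ₂ : Ω₂ → ℝ) (Y : Ω₂ → G) : ℝ :=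
  ent (fun p : Ω₁ × Ω₂ => μ₁ p.1 * μ₂ p.2) (fun p => X p.1 - Y p.2)
    - ent μ₁ X / 2 - ent μ₂ Y / 2

/-- Conditional Ruzsa distance `d[X | Z ; Y | W]`. -/
def condRdist {Ω₁ Ω₂ G T U : Type*} [Fintype Ω₁] [Fintype Ω₂] [AddCommGroup G]
    (μ₁ : Ω₁ → ℝ) (X : Ω₁ → G) (Z : Ω₁ → T)
    (μ₂ : Ω₂ → ℝ) (Y : Ω₂ → G) (W : Ω₂ → U) : ℝ :=
  ∑ z ∈ Finset.univ.image Z, ∑ w ∈ Finset.univ.image W,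
    pmass μ₁ Z z * pmass μ₂ W w * rdist (condMeas μ₁ Z z) X (condMeas μ₂ W w) Y

/-- Conditional Ruzsa distance `d[X ; Y | W]`, conditioning only on the right variable. -/
def condRdistRight {Ω₁ Ω₂ G U : Type*} [Fintype Ω₁] [Fintype Ω₂] [AddCommGroup G]
    (μ₁ : Ω₁ → ℝ) (X : Ω₁ → G)
    (μ₂ : Ω₂ → ℝ) (Y : Ω₂ → G) (W : Ω₂ → U) : ℝ :=
  ∑ w ∈ Finset.univ.image W, pmass μ₂ W w * rdist μ₁ X (condMeas μ₂ W w) Y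

/-- The uniform probability mass function on a subset `H` of a finite type. -/
def unifOn {G : Type*} [Fintype G] (H : Set G) : G → ℝ :=
  fun g => if g ∈ H then ((Nat.card H : ℝ))⁻¹ else 0

/-- `X` (under `μ₁`) and `Y` (under `μ₂`) are identically distributed. -/
def IdentDist {Ω₁ Ω₂ S : Type*} [Fintype Ω₁] [Fintype Ω₂]
    (μ₁ : Ω₁ → ℝ) (X : Ω₁ → S) (μ₂ : Ω₂ → ℝ) (Y : Ω₂ → S) : Prop :=
  ∀ s, pmass μ₁ X s = pmass μ₂ Y s

/-- Two random variables are independent. -/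
def IndepPair {Ω S T : Type*} [Fintype Ω] (μ : Ω → ℝ) (X : Ω → S) (Y : Ω → T) : Prop :=
  ∀ s t, pmass μ (fun ω => (X ω, Y ω)) (s, t) = pmass μ X s * pmass μ Y t

/-- Three random variables are jointly independent. -/
def IndepTriple {Ω S T U : Type*} [Fintype Ω] (μ : Ω → ℝ)
    (X : Ω → S) (Y : Ω → T) (Z : Ω → U) : Prop :=
  ∀ s t u, pmass μ (fun ω => (X ω, Y ω, Z ω)) (s, t, u)
    = pmass μ X s * pmass μ Y t * pmass μ Z u

/-- Four random variables are jointly independent. -/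
def IndepFour {Ω S T U V : Type*} [Fintype Ω] (μ : Ω → ℝ)
    (X : Ω → S) (Y : Ω → T) (Z : Ω → U) (W : Ω → V) : Prop :=
  ∀ s t u v, pmass μ (fun ω => (X ω, Y ω, Z ω, W ω)) (s, t, u, v)
    = pmass μ X s * pmass μ Y t * pmass μ Z u * pmass μ W v



set_option linter.unusedSectionVars false

section basics
variable {Ω Ω' S T U V : Type*} [Fintype Ω] [Fintype Ω'] [Fintype S] [Fintype T] [Fintype U] [Fintype V]

lemma pmass_nonneg {μ : Ω → ℝ} (h : ∀ ω, 0 ≤ μ ω) (X : Ω → S) (s : S) : 0 ≤ pmass μ X s :=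
  Finset.sum_nonneg fun ω _ => by split_ifs <;> simp [h]

lemma sum_pmass_mul (μ : Ω → ℝ) (X : Ω → S) (F : S → ℝ) :
    ∑ s, pmass μ X s * F s = ∑ ω, μ ω * F (X ω) := by
  simp only [pmass, Finset.sum_mul]
  rw [Finset.sum_comm]
  refine Finset.sum_congr rfl fun ω _ => ?_
  simp [ite_mul]

lemma sum_pmass (μ : Ω → ℝ) (X : Ω → S) : ∑ s, pmass μ X s = ∑ ω, μ ω := by
  simpa using sum_pmass_mul μ X (fun _ => 1)

lemma pmass_zero (μ : Ω → ℝ) (X : Ω → S) (s : S) (h : s ∉ Finset.univ.image X) :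
    pmass μ X s = 0 := by
  refine Finset.sum_eq_zero fun ω _ => ?_
  rw [if_neg]
  rintro rfl
  exact h (Finset.mem_image_of_mem _ (Finset.mem_univ _))

lemma ent_eq_sum (μ : Ω → ℝ) (X : Ω → S) : ent μ X = ∑ s, Real.negMulLog (pmass μ X s) := by
  refine Finset.sum_subset (Finset.subset_univ _) fun s _ hs => ?_
  rw [pmass_zero μ X s hs]; simp

lemma ent_eq_log (μ : Ω → ℝ) (X : Ω → S) :
    ent μ X = - ∑ ω, μ ω * Real.log (pmass μ X (X ω)) := by
  rw [ent_eq_sum, ← sum_pmass_mul μ X (fun s => Real.log (pmass μ X s)), ← Finset.sum_neg_distrib]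
  simp [Real.negMulLog]

lemma ent_iff (μ : Ω → ℝ) (X : Ω → S) (Y : Ω → T) (h : ∀ ω ω', X ω = X ω' ↔ Y ω = Y ω') :
    ent μ X = ent μ Y := by
  rw [ent_eq_log, ent_eq_log]
  congr 1
  refine Finset.sum_congr rfl fun ω _ => ?_
  simp only [pmass, h]

lemma pmass_comp (μ : Ω → ℝ) (X : Ω → S) (f : S → T) (t : T) :
    pmass μ (fun ω => f (X ω)) t = ∑ s, pmass μ X s * (if f s = t then 1 else 0) := by
  rw [sum_pmass_mul]; simp [pmass]

lemma ident_comp {μ : Ω → ℝ} {X : Ω → S} {μ' : Ω' → ℝ} {X' : Ω' → S} (h : IdentDist μ X μ' X')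
    (f : S → T) : IdentDist μ (fun ω => f (X ω)) μ' (fun ω => f (X' ω)) := by
  intro t
  simp only [pmass_comp, h _]

lemma ident_ent {μ : Ω → ℝ} {X : Ω → S} {μ' : Ω' → ℝ} {X' : Ω' → S} (h : IdentDist μ X μ' X') :
    ent μ X = ent μ' X' := by
  simp only [ent_eq_sum, h _]

lemma pmass_fst (μ : Ω → ℝ) (X : Ω → S) (Y : Ω → T) (s : S) :
    pmass μ X s = ∑ t, pmass μ (fun ω => (X ω, Y ω)) (s, t) := by
  have := pmass_comp μ (fun ω => (X ω, Y ω)) Prod.fst s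
  simp only at this
  rw [this, Fintype.sum_prod_type, Finset.sum_comm]
  simp

lemma pmass_snd (μ : Ω → ℝ) (X : Ω → S) (Y : Ω → T) (t : T) :
    pmass μ Y t = ∑ s, pmass μ (fun ω => (X ω, Y ω)) (s, t) := by
  have := pmass_comp μ (fun ω => (X ω, Y ω)) Prod.snd t
  simp only at this
  rw [this, Fintype.sum_prod_type]
  simp

lemma indep_comp {μ : Ω → ℝ} {X : Ω → S} {Y : Ω → T} (h : IndepPair μ X Y)
    (f : S → U) (g : T → V) : IndepPair μ (fun ω => f (X ω)) (fun ω => g (Y ω)) := by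
  intro u v
  have := pmass_comp μ (fun ω => (X ω, Y ω)) (fun p => (f p.1, g p.2)) (u, v)
  simp only at this
  rw [this, Fintype.sum_prod_type, pmass_comp, pmass_comp, Finset.sum_mul_sum]
  refine Finset.sum_congr rfl fun s _ => Finset.sum_congr rfl fun t _ => ?_
  rw [h s t]
  by_cases h1 : f s = u <;> by_cases h2 : g t = v <;> simp [h1, h2]

lemma ent_indep {μ : Ω → ℝ} (hμ : IsProb μ) {X : Ω → S} {Y : Ω → T} (h : IndepPair μ X Y) :
    ent μ (fun ω => (X ω, Y ω)) = ent μ X + ent μ Y := by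
  rw [ent_eq_sum, ent_eq_sum, ent_eq_sum, Fintype.sum_prod_type]
  simp only [h _ _, Real.negMulLog_mul, Finset.sum_add_distrib, ← Finset.mul_sum, ← Finset.sum_mul,
    sum_pmass, hμ.2, one_mul]

/-- submodularity -/
lemma ent_submod {μ : Ω → ℝ} (hμ : IsProb μ) (X : Ω → S) (Y : Ω → T) (Z : Ω → U) :
    ent μ (fun ω => (X ω, Y ω, Z ω)) + ent μ Z
      ≤ ent μ (fun ω => (X ω, Z ω)) + ent μ (fun ω => (Y ω, Z ω)) := by
  have hpos' : ∀ ω, 0 < μ ω → 0 < pmass μ Z (Z ω) := by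
    intro ω h
    refine Finset.sum_pos' (fun ω' _ => ?_) ⟨ω, Finset.mem_univ _, by simpa using h⟩
    split_ifs <;> simp [hμ.1]
  set pxz := pmass μ (fun ω => (X ω, Z ω)) with hxz
  set pyz := pmass μ (fun ω => (Y ω, Z ω)) with hyz
  set p := pmass μ (fun ω => (X ω, Y ω, Z ω)) with hp
  set pz := pmass μ Z with hz
  have nz : ∀ z, 0 ≤ pz z := pmass_nonneg hμ.1 Z
  have nxz : ∀ z, 0 ≤ pxz z := pmass_nonneg hμ.1 _
  have nyz : ∀ z, 0 ≤ pyz z := pmass_nonneg hμ.1 _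
  have np : ∀ z, 0 ≤ p z := pmass_nonneg hμ.1 _
  let F : S × T × U → ℝ := fun q => pxz (q.1, q.2.2) * pyz (q.2.1, q.2.2) / (pz q.2.2 * p q)
  have key : ∑ ω, μ ω * F (X ω, Y ω, Z ω) ≤ 1 := by
    rw [← sum_pmass_mul μ (fun ω => (X ω, Y ω, Z ω)) F]
    calc ∑ q, p q * F q ≤ ∑ q : S × T × U, pxz (q.1, q.2.2) * pyz (q.2.1, q.2.2) / pz q.2.2 := by
          refine Finset.sum_le_sum fun q _ => ?_
          rcases eq_or_ne (p q) 0 with h | h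
          · rw [h, zero_mul]; exact div_nonneg (mul_nonneg (nxz _) (nyz _)) (nz _)
          · apply le_of_eq
            simp only [F]
            rw [mul_comm (pz _), ← div_div, mul_div_assoc']
            field_simp
      _ = ∑ z, pz z * pz z / pz z := by
          rw [Fintype.sum_prod_type]
          simp only [Fintype.sum_prod_type]
          simp only [Finset.sum_comm (s := (Finset.univ : Finset T)) (t := (Finset.univ : Finset U))]
          rw [Finset.sum_comm]
          refine Finset.sum_congr rfl fun z _ => ?_
          conv_rhs => rw [hz, pmass_fst μ Z Z]
          rw [← pmass_fst μ Z Z z]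
          simp only [← Finset.sum_div, ← Finset.mul_sum, ← Finset.sum_mul]
          rw [hxz, hyz, ← pmass_snd, ← pmass_snd]
      _ ≤ ∑ z, pz z := by
          refine Finset.sum_le_sum fun z _ => ?_
          rw [mul_self_div_self]
      _ = 1 := by rw [hz, sum_pmass, hμ.2]
  have h2 : ∀ ω, μ ω * (1 - F (X ω, Y ω, Z ω)) ≤
      μ ω * Real.log (p (X ω, Y ω, Z ω)) + μ ω * Real.log (pz (Z ω))
       - μ ω * Real.log (pxz (X ω, Z ω)) - μ ω * Real.log (pyz (Y ω, Z ω)) := by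
    intro ω
    rcases (hμ.1 ω).eq_or_lt with h | h
    · simp [← h]
    have a1 : 0 < pz (Z ω) := hpos' ω h
    have a2 : 0 < p (X ω, Y ω, Z ω) := by
      refine Finset.sum_pos' (fun ω' _ => ?_) ⟨ω, Finset.mem_univ _, by simpa using h⟩
      split_ifs <;> simp [hμ.1]
    have a3 : 0 < pxz (X ω, Z ω) := by
      refine Finset.sum_pos' (fun ω' _ => ?_) ⟨ω, Finset.mem_univ _, by simpa using h⟩
      split_ifs <;> simp [hμ.1]
    have a4 : 0 < pyz (Y ω, Z ω) := by
      refine Finset.sum_pos' (fun ω' _ => ?_) ⟨ω, Finset.mem_univ _, by simpa using h⟩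
      split_ifs <;> simp [hμ.1]
    rw [← mul_add, ← mul_sub, ← mul_sub]
    refine mul_le_mul_of_nonneg_left ?_ h.le
    have := Real.log_le_sub_one_of_pos (x := F (X ω, Y ω, Z ω)) (by simp only [F]; positivity)
    simp only [F] at this ⊢
    rw [Real.log_div (by positivity) (by positivity), Real.log_mul (by positivity) (by positivity),
      Real.log_mul (by positivity) (by positivity)] at this
    linarith
  have h3 := Finset.sum_le_sum fun ω (_ : ω ∈ Finset.univ) => h2 ω
  simp only [mul_sub, mul_one, Finset.sum_sub_distrib, Finset.sum_add_distrib, hμ.2] at h3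
  simp only [ent_eq_log]
  linarith

lemma ent_const (μ : Ω → ℝ) (hμ : IsProb μ) : ent μ (fun _ => ()) = 0 := by
  rw [ent_eq_sum]; simp [pmass, hμ.2]

lemma ent_subadd {μ : Ω → ℝ} (hμ : IsProb μ) (X : Ω → S) (Y : Ω → T) :
    ent μ (fun ω => (X ω, Y ω)) ≤ ent μ X + ent μ Y := by
  have := ent_submod hμ X Y (fun _ => ())
  rw [ent_const μ hμ, ent_iff μ (fun ω => (X ω, Y ω, ())) (fun ω => (X ω, Y ω)) (by simp),
    ent_iff μ (fun ω => (X ω, ())) X (by simp), ent_iff μ (fun ω => (Y ω, ())) Y (by simp)] at this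
  linarith

lemma pmass_cond (μ : Ω → ℝ) (X : Ω → S) (Z : Ω → U) (x : S) (z : U) :
    pmass (condMeas μ Z z) X x = pmass μ (fun ω => (X ω, Z ω)) (x, z) / pmass μ Z z := by
  conv_lhs => rw [pmass]
  conv_rhs => rw [pmass, Finset.sum_div]
  refine Finset.sum_congr rfl fun ω _ => ?_
  by_cases h1 : X ω = x <;> by_cases h2 : Z ω = z <;> simp [condMeas, h1, h2]

lemma cond_prob {μ : Ω → ℝ} (hμ : IsProb μ) (Z : Ω → U) (z : U) (h : pmass μ Z z ≠ 0) :
    IsProb (condMeas μ Z z) := by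
  refine ⟨fun ω => ?_, ?_⟩
  · simp only [condMeas]; split_ifs
    · exact div_nonneg (hμ.1 _) (pmass_nonneg hμ.1 _ _)
    · rfl
  · have : ∀ ω, condMeas μ Z z ω = (if Z ω = z then μ ω else 0) / pmass μ Z z := by
      intro ω; simp only [condMeas]; split_ifs <;> simp
    simp only [this, ← Finset.sum_div]
    exact div_self h

lemma ent_cond {μ : Ω → ℝ} (hμ : IsProb μ) (X : Ω → S) (Z : Ω → U) :
    ∑ z, pmass μ Z z * ent (condMeas μ Z z) X = ent μ (fun ω => (X ω, Z ω)) - ent μ Z := by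
  rw [ent_eq_sum μ (fun ω => (X ω, Z ω)), ent_eq_sum μ Z, Fintype.sum_prod_type, Finset.sum_comm,
    ← Finset.sum_sub_distrib]
  refine Finset.sum_congr rfl fun z _ => ?_
  rw [ent_eq_sum, Finset.mul_sum]
  have e : Real.negMulLog (pmass μ Z z)
      = ∑ x, - (pmass μ (fun ω => (X ω, Z ω)) (x, z) * Real.log (pmass μ Z z)) := by
    rw [Finset.sum_neg_distrib, ← Finset.sum_mul, ← pmass_snd, Real.negMulLog]; ring
  rw [e, ← Finset.sum_sub_distrib]
  refine Finset.sum_congr rfl fun x _ => ?_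
  rw [pmass_cond]
  have le : pmass μ (fun ω => (X ω, Z ω)) (x, z) ≤ pmass μ Z z := by
    rw [pmass_snd μ X Z]
    exact Finset.single_le_sum (f := fun x => pmass μ (fun ω => (X ω, Z ω)) (x, z))
      (fun i _ => pmass_nonneg hμ.1 _ _) (Finset.mem_univ x)
  have n1 := pmass_nonneg hμ.1 (fun ω => (X ω, Z ω)) (x, z)
  rcases eq_or_ne (pmass μ (fun ω => (X ω, Z ω)) (x, z)) 0 with h | h
  · simp [h]
  · have n2 : 0 < pmass μ Z z := lt_of_lt_of_le (lt_of_le_of_ne n1 h.symm) le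
    rw [Real.negMulLog, Real.negMulLog, Real.log_div h n2.ne']
    field_simp
    ring

lemma cmi_eq {μ : Ω → ℝ} (hμ : IsProb μ) (X : Ω → S) (Y : Ω → T) (Z : Ω → U) :
    condMutualInfo μ X Y Z = ent μ (fun ω => (X ω, Z ω)) + ent μ (fun ω => (Y ω, Z ω))
      - ent μ (fun ω => ((X ω, Y ω), Z ω)) - ent μ Z := by
  have e : condMutualInfo μ X Y Z = ∑ z, pmass μ Z z * mutualInfo (condMeas μ Z z) X Y := by
    refine Finset.sum_subset (Finset.subset_univ _) fun s _ hs => ?_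
    rw [pmass_zero μ Z s hs]; simp
  rw [e]
  simp only [mutualInfo, mul_add, mul_sub, Finset.sum_add_distrib, Finset.sum_sub_distrib,
    ent_cond hμ]
  ring

/-- product measure -/
def pr (μ : Ω → ℝ) (ν : Ω' → ℝ) : Ω × Ω' → ℝ := fun p => μ p.1 * ν p.2

lemma pr_prob {μ : Ω → ℝ} {ν : Ω' → ℝ} (hμ : IsProb μ) (hν : IsProb ν) : IsProb (pr μ ν) := by
  refine ⟨fun p => mul_nonneg (hμ.1 _) (hν.1 _), ?_⟩
  simp only [pr]
  rw [Fintype.sum_prod_type]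
  simp only [← Finset.mul_sum, hν.2, mul_one, hμ.2]

lemma pmass_pr (μ : Ω → ℝ) (ν : Ω' → ℝ) (X : Ω → S) (Y : Ω' → T) (s : S) (t : T) :
    pmass (pr μ ν) (fun p => (X p.1, Y p.2)) (s, t) = pmass μ X s * pmass ν Y t := by
  simp only [pmass, Finset.sum_mul_sum]
  rw [Fintype.sum_prod_type]
  refine Finset.sum_congr rfl fun a _ => Finset.sum_congr rfl fun b _ => ?_
  by_cases h1 : X a = s <;> by_cases h2 : Y b = t <;> simp [h1, h2, pr]

lemma pmass_pr_fst {μ : Ω → ℝ} {ν : Ω' → ℝ} (hν : IsProb ν) (X : Ω → S) (s : S) :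
    pmass (pr μ ν) (fun p => X p.1) s = pmass μ X s := by
  rw [pmass_fst (pr μ ν) (fun p => X p.1) (fun p : Ω × Ω' => p.2)]
  have := pmass_pr μ ν X (fun p : Ω' => p)
  simp only [this, ← Finset.mul_sum, sum_pmass, hν.2, mul_one]

lemma pmass_pr_snd {μ : Ω → ℝ} {ν : Ω' → ℝ} (hμ : IsProb μ) (Y : Ω' → S) (s : S) :
    pmass (pr μ ν) (fun p => Y p.2) s = pmass ν Y s := by
  rw [pmass_snd (pr μ ν) (fun p : Ω × Ω' => p.1) (fun p => Y p.2)]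
  have := pmass_pr μ ν (fun p : Ω => p) Y
  simp only [this, ← Finset.sum_mul, sum_pmass, hμ.2, one_mul]

lemma pr_indep {μ : Ω → ℝ} {ν : Ω' → ℝ} (hμ : IsProb μ) (hν : IsProb ν) (X : Ω → S) (Y : Ω' → T) :
    IndepPair (pr μ ν) (fun p => X p.1) (fun p => Y p.2) := by
  intro s t
  rw [pmass_pr, pmass_pr_fst hν, pmass_pr_snd hμ]

lemma ent_pr_fst {μ : Ω → ℝ} {ν : Ω' → ℝ} (hν : IsProb ν) (X : Ω → S) :
    ent (pr μ ν) (fun p => X p.1) = ent μ X := ident_ent (pmass_pr_fst hν X)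

lemma ent_pr_snd {μ : Ω → ℝ} {ν : Ω' → ℝ} (hμ : IsProb μ) (X : Ω' → S) :
    ent (pr μ ν) (fun p => X p.2) = ent ν X := ident_ent (pmass_pr_snd hμ X)

lemma pr_ident {μ : Ω → ℝ} {X : Ω → S} {Y : Ω → T} (h : IndepPair μ X Y) :
    IdentDist (pr μ μ) (fun p => (X p.1, Y p.2)) μ (fun ω => (X ω, Y ω)) := by
  rintro ⟨s, t⟩
  rw [pmass_pr, h]

lemma cond_pr (μ : Ω → ℝ) (ν : Ω' → ℝ) (Z : Ω → S) (W : Ω' → T) (z : S) (w : T) :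
    condMeas (pr μ ν) (fun p => (Z p.1, W p.2)) (z, w) = pr (condMeas μ Z z) (condMeas ν W w) := by
  funext p
  simp only [condMeas, pmass_pr]
  by_cases h1 : Z p.1 = z <;> by_cases h2 : W p.2 = w <;> simp [condMeas, h1, h2, pr, mul_div_mul_comm]

lemma cond_pr_snd {μ : Ω → ℝ} (hμ : IsProb μ) (ν : Ω' → ℝ) (W : Ω' → T) (w : T) :
    condMeas (pr μ ν) (fun p => W p.2) w = pr μ (condMeas ν W w) := by
  funext p
  simp only [condMeas, pmass_pr_snd hμ]
  by_cases h2 : W p.2 = w <;> simp [condMeas, h2, pr, mul_div_assoc]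

end basics

section group
variable {Ω Ω₀ Ω₀' G T U : Type*} [Fintype Ω] [Fintype Ω₀] [Fintype Ω₀'] [Fintype G] [AddCommGroup G] [Fintype T] [Fintype U]

lemma rdist_add {μ₀ : Ω₀ → ℝ} {μ : Ω → ℝ} (h₀ : IsProb μ₀) (hμ : IsProb μ) (X₀ : Ω₀ → G)
    {X V : Ω → G} (h : IndepPair μ X V) :
    rdist μ₀ X₀ μ (fun ω => X ω + V ω) - rdist μ₀ X₀ μ X
      ≤ (ent μ (fun ω => X ω + V ω) - ent μ X) / 2 := by
  have hp := pr_prob h₀ hμ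
  have s := ent_submod hp (fun p => X₀ p.1) (fun p => V p.2) (fun p => X₀ p.1 - (X p.2 + V p.2))
  have e1 : ent (pr μ₀ μ) (fun p => (X₀ p.1, V p.2, X₀ p.1 - (X p.2 + V p.2)))
      = ent μ₀ X₀ + (ent μ X + ent μ V) := by
    rw [← ent_indep hμ h, ← ent_pr_fst (μ := μ₀) hμ X₀,
      ← ent_pr_snd (ν := μ) h₀ (fun ω => (X ω, V ω)),
      ← ent_indep hp (pr_indep h₀ hμ X₀ (fun ω => (X ω, V ω)))]
    refine ent_iff _ _ _ fun a b => ?_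
    simp only [Prod.mk.injEq]
    constructor
    · rintro ⟨h1, h2, h3⟩
      rw [h1, h2] at h3
      exact ⟨h1, by simpa using h3, h2⟩
    · rintro ⟨h1, h2, h3⟩
      simp [h1, h2, h3]
  have e2 : ent (pr μ₀ μ) (fun p => (X₀ p.1, X₀ p.1 - (X p.2 + V p.2)))
      ≤ ent μ₀ X₀ + ent μ (fun ω => X ω + V ω) := by
    rw [← ent_pr_fst (μ := μ₀) hμ X₀, ← ent_pr_snd (ν := μ) h₀ (fun ω => X ω + V ω)]
    refine le_trans (le_of_eq ?_) (ent_subadd hp _ _)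
    refine ent_iff _ _ _ fun a b => ?_
    simp only [Prod.mk.injEq]
    constructor
    · rintro ⟨h1, h3⟩
      rw [h1] at h3
      exact ⟨h1, by simpa using h3⟩
    · rintro ⟨h1, h2⟩
      simp [h1, h2]
  have e3 : ent (pr μ₀ μ) (fun p => (V p.2, X₀ p.1 - (X p.2 + V p.2)))
      ≤ ent μ V + ent (pr μ₀ μ) (fun p => X₀ p.1 - X p.2) := by
    rw [← ent_pr_snd (ν := μ) h₀ V]
    refine le_trans (le_of_eq ?_) (ent_subadd hp _ _)
    refine ent_iff _ _ _ fun a b => ?_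
    simp only [Prod.mk.injEq]
    constructor
    · rintro ⟨h1, h3⟩
      rw [h1, ← sub_sub, ← sub_sub] at h3
      exact ⟨h1, by simpa using h3⟩
    · rintro ⟨h1, h2⟩
      rw [← sub_sub, ← sub_sub]
      simp [h1, h2]
  change ent (pr μ₀ μ) (fun p => X₀ p.1 - (X p.2 + V p.2)) - _ - _
    - (ent (pr μ₀ μ) (fun p => X₀ p.1 - X p.2) - _ - _) ≤ _
  linarith

lemma rdist_cond {μ₀ : Ω₀ → ℝ} {μ : Ω → ℝ} (h₀ : IsProb μ₀) (hμ : IsProb μ) (X₀ : Ω₀ → G)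
    (X : Ω → G) (Z : Ω → T) :
    ∑ z, pmass μ Z z * rdist μ₀ X₀ (condMeas μ Z z) X
      ≤ rdist μ₀ X₀ μ X + ent μ X / 2 - (ent μ (fun ω => (X ω, Z ω)) - ent μ Z) / 2 := by
  have hp := pr_prob h₀ hμ
  have c1 := ent_cond hp (fun p => X₀ p.1 - X p.2) (fun p => Z p.2)
  simp only [cond_pr_snd h₀, pmass_pr_snd h₀] at c1
  have c2 := ent_subadd hp (fun p => X₀ p.1 - X p.2) (fun p => Z p.2)
  have c3 := ent_cond hμ X Z
  have c4 : ∑ z, pmass μ Z z = 1 := by rw [sum_pmass, hμ.2]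
  have e : ∀ z, pmass μ Z z * rdist μ₀ X₀ (condMeas μ Z z) X
    = pmass μ Z z * ent (pr μ₀ (condMeas μ Z z)) (fun p => X₀ p.1 - X p.2)
      - pmass μ Z z * (ent μ₀ X₀ / 2) - (pmass μ Z z * ent (condMeas μ Z z) X) / 2 := by
    intro z
    change pmass μ Z z * (ent (pr μ₀ (condMeas μ Z z)) (fun p => X₀ p.1 - X p.2) - _ - _) = _
    ring
  simp only [e, Finset.sum_sub_distrib, ← Finset.sum_mul, ← Finset.sum_div, c1, c3, c4]
  change _ ≤ (ent (pr μ₀ μ) (fun p => X₀ p.1 - X p.2) - _ - _) + _ - _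
  linarith

lemma rdist_indep {μ : Ω → ℝ} {X Y : Ω → G} (h : IndepPair μ X Y) :
    rdist μ X μ Y = ent μ (fun ω => X ω - Y ω) - ent μ X / 2 - ent μ Y / 2 := by
  have := ident_ent (ident_comp (pr_ident h) (fun p => p.1 - p.2))
  rw [← this]; rfl

lemma rdist_cond_cond {μ : Ω → ℝ} (hμ : IsProb μ) {X Y : Ω → G} {Z : Ω → T} {W : Ω → U}
    (h : IndepPair μ (fun ω => (X ω, Z ω)) (fun ω => (Y ω, W ω))) :
    ∑ z, ∑ w, pmass μ Z z * pmass μ W w * rdist (condMeas μ Z z) X (condMeas μ W w) Y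
      = ent μ (fun ω => (X ω - Y ω, Z ω, W ω)) - ent μ Z - ent μ W
        - (ent μ (fun ω => (X ω, Z ω)) - ent μ Z) / 2
        - (ent μ (fun ω => (Y ω, W ω)) - ent μ W) / 2 := by
  have hp := pr_prob hμ hμ
  have c1 := ent_cond hp (fun p => X p.1 - Y p.2) (fun p => (Z p.1, W p.2))
  rw [Fintype.sum_prod_type] at c1
  simp only [cond_pr, pmass_pr] at c1
  rw [ent_indep hp (pr_indep hμ hμ Z W), ent_pr_fst hμ, ent_pr_snd hμ] at c1
  have c0 := ident_ent (ident_comp (pr_ident h) (fun p => (p.1.1 - p.2.1, p.1.2, p.2.2)))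
  simp only at c0
  rw [c0] at c1
  have c3 := ent_cond hμ X Z
  have c3' := ent_cond hμ Y W
  have c4 : ∑ z, pmass μ Z z = 1 := by rw [sum_pmass, hμ.2]
  have c4' : ∑ z, pmass μ W z = 1 := by rw [sum_pmass, hμ.2]
  have e : ∀ z w, pmass μ Z z * pmass μ W w * rdist (condMeas μ Z z) X (condMeas μ W w) Y
    = pmass μ Z z * pmass μ W w * ent (pr (condMeas μ Z z) (condMeas μ W w)) (fun p => X p.1 - Y p.2)
      - pmass μ Z z * ent (condMeas μ Z z) X / 2 * pmass μ W w
      - pmass μ Z z * (pmass μ W w * ent (condMeas μ W w) Y / 2) := by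
    intro z w
    change pmass μ Z z * pmass μ W w *
      (ent (pr (condMeas μ Z z) (condMeas μ W w)) (fun p => X p.1 - Y p.2) - _ - _) = _
    ring
  simp only [e, Finset.sum_sub_distrib, ← Finset.sum_mul, ← Finset.mul_sum, ← Finset.sum_div, c1, c3,
    c3', c4, c4']
  ring

lemma indepFour_pair {μ : Ω → ℝ} (hμ : IsProb μ) {A B C D : Ω → G} (h : IndepFour μ A B C D) :
    IndepPair μ A B ∧ IndepPair μ C D ∧
    IndepPair μ (fun ω => (A ω, B ω)) (fun ω => (C ω, D ω)) := by
  have s : ∀ X : Ω → G, ∑ x, pmass μ X x = 1 := fun X => by rw [sum_pmass, hμ.2]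
  have h' : ∀ a b c d, pmass μ (fun ω => ((A ω, B ω), (C ω, D ω))) ((a, b), (c, d))
      = pmass μ A a * pmass μ B b * pmass μ C c * pmass μ D d := by
    intro a b c d
    rw [← h a b c d]
    simp only [pmass, Prod.mk.injEq, and_assoc]
  have h1 : IndepPair μ A B := by
    intro a b
    rw [pmass_fst μ (fun ω => (A ω, B ω)) (fun ω => (C ω, D ω)), Fintype.sum_prod_type]
    simp only [h', ← Finset.mul_sum, s, mul_one]
  have h2 : IndepPair μ C D := by
    intro a b
    rw [pmass_snd μ (fun ω => (A ω, B ω)) (fun ω => (C ω, D ω)), Fintype.sum_prod_type]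
    simp only [h', ← Finset.mul_sum, ← Finset.sum_mul, s, mul_one, one_mul]
  refine ⟨h1, h2, ?_⟩
  rintro ⟨a, b⟩ ⟨c, d⟩
  rw [h', h1, h2]; ring

/-- consequences of minimality -/
lemma min_cons {G Ω Ω₀ Ω₀' : Type} [Fintype G] [AddCommGroup G] [Fintype Ω] [Fintype Ω₀] [Fintype Ω₀']
    {μ : Ω → ℝ} {μ₀ : Ω₀ → ℝ} {μ₀' : Ω₀' → ℝ} (hμ : IsProb μ)
    (h₀ : IsProb μ₀) (h₀' : IsProb μ₀') (X₀ : Ω₀ → G) (X₀' : Ω₀' → G) (X₁ X₂ V₁ V₂ : Ω → G)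
    (h : IndepFour μ X₁ V₁ X₂ V₂) 
    (hmin : ∀ (Ω₁' : Type) [Fintype Ω₁'] (Ω₂' : Type) [Fintype Ω₂']
      (μ₁' : Ω₁' → ℝ) (μ₂' : Ω₂' → ℝ), IsProb μ₁' → IsProb μ₂' →
      ∀ (X₁' : Ω₁' → G) (X₂' : Ω₂' → G),
        rdist μ X₁ μ X₂ + (1/9) * rdist μ₀ X₀ μ X₁ + (1/9) * rdist μ₀' X₀' μ X₂
          ≤ rdist μ₁' X₁' μ₂' X₂' + (1/9) * rdist μ₀ X₀ μ₁' X₁'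
            + (1/9) * rdist μ₀' X₀' μ₂' X₂') :
    rdist μ X₁ μ X₂ ≤ ent μ (fun ω => X₁ ω + V₁ ω - (X₂ ω + V₂ ω))
        - ent μ (fun ω => X₁ ω + V₁ ω) / 2 - ent μ (fun ω => X₂ ω + V₂ ω) / 2
        + (1/18) * (ent μ (fun ω => X₁ ω + V₁ ω) - ent μ X₁
          + (ent μ (fun ω => X₂ ω + V₂ ω) - ent μ X₂)) ∧
    rdist μ X₁ μ X₂ ≤ ent μ (fun ω => (X₁ ω - X₂ ω, X₁ ω + V₁ ω, X₂ ω + V₂ ω))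
        - ent μ (fun ω => X₁ ω + V₁ ω) / 2 - ent μ (fun ω => X₂ ω + V₂ ω) / 2
        - (ent μ X₁ + ent μ V₁) / 2 - (ent μ X₂ + ent μ V₂) / 2
        + (1/18) * (ent μ (fun ω => X₁ ω + V₁ ω) - ent μ V₁
          + (ent μ (fun ω => X₂ ω + V₂ ω) - ent μ V₂)) := by
  obtain ⟨i1, i2, i12⟩ := indepFour_pair hμ h
  constructor
  · have m := hmin Ω Ω μ μ hμ hμ (fun ω => X₁ ω + V₁ ω) (fun ω => X₂ ω + V₂ ω)
    have a1 := rdist_add h₀ hμ X₀ i1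
    have a2 := rdist_add h₀' hμ X₀' i2
    rw [rdist_indep (X := fun ω => X₁ ω + V₁ ω) (Y := fun ω => X₂ ω + V₂ ω)
      (indep_comp i12 (fun p => p.1 + p.2) (fun p => p.1 + p.2))] at m
    linarith
  · set Z : Ω → G := fun ω => X₁ ω + V₁ ω with hZ
    set W : Ω → G := fun ω => X₂ ω + V₂ ω with hW
    have c4 : ∑ z, pmass μ Z z = 1 := by rw [sum_pmass, hμ.2]
    have c4' : ∑ z, pmass μ W z = 1 := by rw [sum_pmass, hμ.2]
    have m : ∑ z, ∑ w, pmass μ Z z * pmass μ W w *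
          (rdist μ X₁ μ X₂ + (1/9) * rdist μ₀ X₀ μ X₁ + (1/9) * rdist μ₀' X₀' μ X₂)
        ≤ ∑ z, ∑ w, (pmass μ Z z * pmass μ W w * rdist (condMeas μ Z z) X₁ (condMeas μ W w) X₂
          + (1/9) * (pmass μ Z z * rdist μ₀ X₀ (condMeas μ Z z) X₁) * pmass μ W w
          + pmass μ Z z * ((1/9) * (pmass μ W w * rdist μ₀' X₀' (condMeas μ W w) X₂))) := by
      refine Finset.sum_le_sum fun z _ => Finset.sum_le_sum fun w _ => ?_
      rcases eq_or_ne (pmass μ Z z) 0 with h1 | h1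
      · simp [h1]
      rcases eq_or_ne (pmass μ W w) 0 with h2 | h2
      · simp [h2]
      have := mul_le_mul_of_nonneg_left (hmin Ω Ω _ _ (cond_prob hμ Z z h1) (cond_prob hμ W w h2) X₁ X₂)
        (mul_nonneg (pmass_nonneg hμ.1 Z z) (pmass_nonneg hμ.1 W w))
      refine this.trans (le_of_eq ?_)
      ring
    simp only [Finset.sum_add_distrib, ← Finset.sum_mul, ← Finset.mul_sum, c4, c4', one_mul,
      mul_one] at m
    rw [rdist_cond_cond hμ (indep_comp i12 (fun p => (p.1, p.1 + p.2)) (fun p => (p.1, p.1 + p.2)))] at m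
    have r1 := rdist_cond h₀ hμ X₀ X₁ Z
    have r2 := rdist_cond h₀' hμ X₀' X₂ W
    have e1 : ent μ (fun ω => (X₁ ω, Z ω)) = ent μ X₁ + ent μ V₁ := by
      rw [← ent_indep hμ i1]
      refine ent_iff _ _ _ fun a b => ?_
      simp only [hZ, Prod.mk.injEq]
      refine and_congr_right fun h => ?_
      rw [h]; simp
    have e2 : ent μ (fun ω => (X₂ ω, W ω)) = ent μ X₂ + ent μ V₂ := by
      rw [← ent_indep hμ i2]
      refine ent_iff _ _ _ fun a b => ?_
      simp only [hW, Prod.mk.injEq]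
      refine and_congr_right fun h => ?_
      rw [h]; simp
    rw [e1] at m r1
    rw [e2] at m r2
    linarith

end group

/-- **The second estimate (Section 6).** In the setting of the first estimate (with
`η = 1/9`, `(X₁, X₂)` a `τ`-minimizer, `X̃₁, X̃₂` independent copies, `k := d[X₁;X₂]`,
and `I₁ := I[X₁ + X₂ : X̃₁ + X₂ | X₁ + X₂ + X̃₁ + X̃₂]`):
`I₂ := I[X₁ + X₂ : X₁ + X̃₁ | X₁ + X₂ + X̃₁ + X̃₂] ≤ 2ηk + 2η(2ηk - I₁)/(1 - η)`. -/
theorem second_estimate {n : ℕ} {Ω₀₁ Ω₀₂ Ω : Type} [Fintype Ω₀₁] [Fintype Ω₀₂] [Fintype Ω]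
    (μ₀₁ : Ω₀₁ → ℝ) (μ₀₂ : Ω₀₂ → ℝ) (μ : Ω → ℝ)
    (hμ₀₁ : IsProb μ₀₁) (hμ₀₂ : IsProb μ₀₂) (hμ : IsProb μ)
    (X₀₁ : Ω₀₁ → (Fin n → ZMod 2)) (X₀₂ : Ω₀₂ → (Fin n → ZMod 2))
    (X₁ X₂ Y₁ Y₂ : Ω → (Fin n → ZMod 2))
    (hindep : IndepFour μ X₁ X₂ Y₁ Y₂)
    (hY₁ : IdentDist μ Y₁ μ X₁) (hY₂ : IdentDist μ Y₂ μ X₂)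
    (k : ℝ) (hk : rdist μ X₁ μ X₂ = k)
    (hmin : ∀ (Ω₁' : Type) [Fintype Ω₁'] (Ω₂' : Type) [Fintype Ω₂']
      (μ₁' : Ω₁' → ℝ) (μ₂' : Ω₂' → ℝ), IsProb μ₁' → IsProb μ₂' →
      ∀ (X₁' : Ω₁' → (Fin n → ZMod 2)) (X₂' : Ω₂' → (Fin n → ZMod 2)),
        rdist μ X₁ μ X₂ + (1/9) * rdist μ₀₁ X₀₁ μ X₁ + (1/9) * rdist μ₀₂ X₀₂ μ X₂
          ≤ rdist μ₁' X₁' μ₂' X₂' + (1/9) * rdist μ₀₁ X₀₁ μ₁' X₁'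
            + (1/9) * rdist μ₀₂ X₀₂ μ₂' X₂') :
    condMutualInfo μ (fun ω => X₁ ω + X₂ ω) (fun ω => X₁ ω + Y₁ ω)
        (fun ω => X₁ ω + X₂ ω + Y₁ ω + Y₂ ω)
      ≤ 2 * (1/9) * k
        + 2 * (1/9) * (2 * (1/9) * k
            - condMutualInfo μ (fun ω => X₁ ω + X₂ ω) (fun ω => Y₁ ω + X₂ ω)
                (fun ω => X₁ ω + X₂ ω + Y₁ ω + Y₂ ω)) / (1 - 1/9) := by
  have hs : ∀ a b : Fin n → ZMod 2, a - b = a + b := by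
    intro a b; funext i; exact CharTwo.sub_eq_add _ _
  have hn : ∀ a : Fin n → ZMod 2, a + a = 0 := by
    intro a; rw [← hs]; simp
  have q1 : IndepFour μ X₁ Y₂ X₂ Y₁ := by
    intro a b c d
    have e := hindep a c d b
    rw [hY₁, hY₂] at *
    refine Eq.trans ?_ (e.trans (by ring))
    simp only [pmass, Prod.mk.injEq]
    refine Finset.sum_congr rfl fun ω _ => if_congr (by tauto) rfl rfl
  have q2 : IndepFour μ X₁ Y₁ X₂ Y₂ := by
    intro a b c d
    have e := hindep a c b d
    rw [hY₁, hY₂] at *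
    refine Eq.trans ?_ (e.trans (by ring))
    simp only [pmass, Prod.mk.injEq]
    refine Finset.sum_congr rfl fun ω _ => if_congr (by tauto) rfl rfl
  obtain ⟨a1, a2, a3⟩ := indepFour_pair hμ hindep
  obtain ⟨b1, b2, b3⟩ := indepFour_pair hμ q1
  obtain ⟨c1, c2, c3⟩ := indepFour_pair hμ q2
  have m1 := (min_cons hμ hμ₀₁ hμ₀₂ X₀₁ X₀₂ X₁ X₂ Y₂ Y₁ q1 hmin).2
  obtain ⟨m2, m3⟩ := min_cons hμ hμ₀₁ hμ₀₂ X₀₁ X₀₂ X₁ X₂ Y₁ Y₂ q2 hmin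
  have hk' := rdist_indep a1
  have hE1 := ident_ent hY₁
  have hE2 := ident_ent hY₂
  simp only [hs] at m1 m2 m3 hk'
  -- sums with the same law
  have t1 : ent μ (fun ω => Y₁ ω + Y₂ ω) = ent μ (fun ω => X₁ ω + X₂ ω) := by
    refine ident_ent (ident_comp (X := fun ω => (Y₁ ω, Y₂ ω)) (X' := fun ω => (X₁ ω, X₂ ω)) ?_
      (fun p => p.1 + p.2))
    rintro ⟨s, t⟩
    rw [a1, a2, hY₁, hY₂]
  have t2 : ent μ (fun ω => X₁ ω + Y₂ ω) = ent μ (fun ω => X₁ ω + X₂ ω) := by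
    refine ident_ent (ident_comp (X := fun ω => (X₁ ω, Y₂ ω)) (X' := fun ω => (X₁ ω, X₂ ω)) ?_
      (fun p => p.1 + p.2))
    rintro ⟨s, t⟩
    rw [a1, b1, hY₂]
  have t3 : ent μ (fun ω => X₂ ω + Y₁ ω) = ent μ (fun ω => X₁ ω + X₂ ω) := by
    have e : (fun ω => X₁ ω + X₂ ω) = (fun ω => X₂ ω + X₁ ω) := by funext ω; exact add_comm _ _
    rw [e]
    refine ident_ent (ident_comp (X := fun ω => (X₂ ω, Y₁ ω)) (X' := fun ω => (X₂ ω, X₁ ω)) ?_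
      (fun p => p.1 + p.2))
    rintro ⟨s, t⟩
    rw [b2, hY₁]
    have := a1 t s
    rw [mul_comm, ← this]
    simp only [pmass, Prod.mk.injEq, and_comm]
  have u1 := ent_indep hμ (indep_comp a3 (fun p => p.1 + p.2) (fun p => p.1 + p.2))
  have u2 := ent_indep hμ (indep_comp b3 (fun p => p.1 + p.2) (fun p => p.1 + p.2))
  have u3 := ent_indep hμ (indep_comp c3 (fun p => p.1 + p.2) (fun p => p.1 + p.2))
  simp only at u1 u2 u3
  rw [cmi_eq hμ, cmi_eq hμ]
  have v1 : ent μ (fun ω => (X₁ ω + X₂ ω, X₁ ω + X₂ ω + Y₁ ω + Y₂ ω))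
      = ent μ (fun ω => (X₁ ω + X₂ ω, Y₁ ω + Y₂ ω)) := by
    refine ent_iff _ _ _ fun a b => ?_
    simp only [Prod.mk.injEq]
    grind
  have v2 : ent μ (fun ω => (Y₁ ω + X₂ ω, X₁ ω + X₂ ω + Y₁ ω + Y₂ ω))
      = ent μ (fun ω => (X₁ ω + Y₂ ω, X₂ ω + Y₁ ω)) := by
    refine ent_iff _ _ _ fun a b => ?_
    simp only [Prod.mk.injEq]
    grind
  have v3 : ent μ (fun ω => (X₁ ω + Y₁ ω, X₁ ω + X₂ ω + Y₁ ω + Y₂ ω))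
      = ent μ (fun ω => (X₁ ω + Y₁ ω, X₂ ω + Y₂ ω)) := by
    refine ent_iff _ _ _ fun a b => ?_
    simp only [Prod.mk.injEq]
    grind
  have v4 : ent μ (fun ω => ((X₁ ω + X₂ ω, Y₁ ω + X₂ ω), X₁ ω + X₂ ω + Y₁ ω + Y₂ ω))
      = ent μ (fun ω => (X₁ ω + X₂ ω, X₁ ω + Y₂ ω, X₂ ω + Y₁ ω)) := by
    refine ent_iff _ _ _ fun a b => ?_
    simp only [Prod.mk.injEq]
    grind
  have v5 : ent μ (fun ω => ((X₁ ω + X₂ ω, X₁ ω + Y₁ ω), X₁ ω + X₂ ω + Y₁ ω + Y₂ ω))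
      = ent μ (fun ω => (X₁ ω + X₂ ω, X₁ ω + Y₁ ω, X₂ ω + Y₂ ω)) := by
    refine ent_iff _ _ _ fun a b => ?_
    simp only [Prod.mk.injEq]
    grind
  have v6 : ent μ (fun ω => X₁ ω + Y₁ ω + (X₂ ω + Y₂ ω))
      = ent μ (fun ω => X₁ ω + X₂ ω + Y₁ ω + Y₂ ω) := by
    congr 1; funext ω; abel
  rw [v6] at m2
  rw [v1, v2, v3, v4, v5, u1, u2, u3, t1, t2, t3]
  rw [t2, t3] at m1
  rw [hE1, hE2] at m1 m3
  rw [hk] at m1 m2 m3 hk'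
  rw [show (1 : ℝ) - 1 / 9 = 8 / 9 by norm_num]
  linarith

end
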